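/- Let P ⊆ ℝⁿ be a bounded convex set of positive Lebesgue measure. Then S_{d·P} = d·S_P for every real number d > 0, and S_{P+v} = S_P for every v ∈ ℝⁿ, where P + v denotes the translate {p + v : p ∈ P}. -/

import Mathlib

open MvPolynomial

/-- A monomial order on ℕⁿ: a linear order (total, antisymmetric, transitive)
that is a well-order and is compatible with addition. -/
def IsMonomialOrder (n : ℕ) (r : (Fin n → ℕ) → (Fin n → ℕ) → Prop) : Prop :=
  (∀ a b, r a b ∨ r b a) ∧
  (∀ a b, r a b → r b a → a = b) ∧
  (∀ a b c, r a b → r b c → r a c) ∧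
  WellFounded (fun a b => r a b ∧ a ≠ b) ∧
  (∀ a b c, r a b → r (a + c) (b + c))

/-- `e` is the exponent of the leading monomial of `p` w.r.t. the monomial order `r`. -/
def IsLeadMon {n : ℕ} (r : (Fin n → ℕ) → (Fin n → ℕ) → Prop)
    (p : MvPolynomial (Fin n) ℝ) (e : Fin n → ℕ) : Prop :=
  (∃ d ∈ p.support, ⇑d = e) ∧ ∀ d ∈ p.support, r (⇑d) e

/-- `E_A`: the set of exponents `e` such that no (nonzero) polynomial vanishing on `A`
has leading monomial `X^e`. -/
def ESet {n : ℕ} (r : (Fin n → ℕ) → (Fin n → ℕ) → Prop)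
    (A : Set (Fin n → ℝ)) : Set (Fin n → ℕ) :=
  {e | ¬ ∃ p : MvPolynomial (Fin n) ℝ, (∀ a ∈ A, eval a p = 0) ∧ IsLeadMon r p e}

open Pointwise MeasureTheory

/-- The lattice `ℤⁿ` viewed as a subset of `ℝⁿ`. -/
def latticePoints (n : ℕ) : Set (Fin n → ℝ) := {x | ∀ i, ∃ m : ℤ, x i = (m : ℝ)}

/-- `S_P`: the closure of the increasing union `⋃ₖ 2⁻ᵏ·E_{2ᵏ·P ∩ ℤⁿ}`,
viewing each `E_{2ᵏ·P ∩ ℤⁿ} ⊆ ℕⁿ` as a subset of `ℝⁿ`. -/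
noncomputable def SP {n : ℕ} (r : (Fin n → ℕ) → (Fin n → ℕ) → Prop)
    (P : Set (Fin n → ℝ)) : Set (Fin n → ℝ) :=
  closure (⋃ k : ℕ,
    (fun (e : Fin n → ℕ) (i : Fin n) => (e i : ℝ) / 2 ^ k) ''
      ESet r (((2 ^ k : ℝ) • P) ∩ latticePoints n))

lemma IsMonomialOrder.le_of_add_le_add {n : ℕ} {r : (Fin n → ℕ) → (Fin n → ℕ) → Prop}
    (hr : IsMonomialOrder n r) {a b c : Fin n → ℕ} (h : r (a + c) (b + c)) : r a b := by
  obtain ⟨htot, hanti, -, -, hadd⟩ := hr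
  rcases htot a b with hab | hba
  · exact hab
  · have : a = b := add_right_cancel (hanti _ _ h (hadd _ _ c hba))
    subst this
    exact hba

lemma IsMonomialOrder.eq_zero_of_le_zero {n : ℕ} {r : (Fin n → ℕ) → (Fin n → ℕ) → Prop}
    (hr : IsMonomialOrder n r) {a : Fin n → ℕ} (h : r a 0) : a = 0 := by
  obtain ⟨-, -, htrans, hwf, hadd⟩ := hr
  by_contra ha
  obtain ⟨m, ⟨hm, hm0⟩, hmin⟩ := hwf.has_min {a | r a 0 ∧ a ≠ 0} ⟨a, h, ha⟩
  have hmm : r (m + m) m := by simpa using hadd _ _ m hm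
  exact hmin (m + m) ⟨htrans _ _ _ hmm hm, by simpa using hm0⟩ ⟨hmm, by simpa using hm0⟩

lemma ESet_mono {n : ℕ} (r : (Fin n → ℕ) → (Fin n → ℕ) → Prop) {A B : Set (Fin n → ℝ)}
    (h : A ⊆ B) : ESet r A ⊆ ESet r B :=
  fun _ he ⟨p, hp, hl⟩ => he ⟨p, fun a ha => hp a (h ha), hl⟩

lemma zero_mem_ESet_singleton {n : ℕ} {r : (Fin n → ℕ) → (Fin n → ℕ) → Prop}
    (hr : IsMonomialOrder n r) (v : Fin n → ℝ) : 0 ∈ ESet r {v} := by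
  rintro ⟨p, hp, ⟨d, hd, hd0⟩, hle⟩
  have hsupp : ∀ d ∈ p.support, d = 0 := fun d hd =>
    DFunLike.coe_injective (hr.eq_zero_of_le_zero (hle d hd))
  obtain rfl := hsupp d hd
  have hpC : p = C (p.coeff 0) := by
    ext d
    rw [coeff_C]
    split_ifs with h
    · rw [← h]
    · by_contra hne
      exact h (hsupp d (mem_support_iff.2 hne)).symm
  have h0 := hp v rfl
  rw [hpC, eval_C] at h0
  exact mem_support_iff.1 hd h0

/-- The monomial function `y ↦ y ^ g` restricted to `B`. -/
def monomialOn {n : ℕ} (B : Set (Fin n → ℝ)) (g : Fin n → ℕ) : B → ℝ :=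
  fun y => ∏ k, y.1 k ^ g k

lemma exists_dual_of_mem_ESet {n : ℕ} {r : (Fin n → ℕ) → (Fin n → ℕ) → Prop}
    (hr : IsMonomialOrder n r) {B : Set (Fin n → ℝ)} {f : Fin n → ℕ} (hf : f ∈ ESet r B) :
    ∃ ψ : (B → ℝ) →ₗ[ℝ] ℝ, ψ (monomialOn B f) ≠ 0 ∧
      ∀ g, r g f → g ≠ f → ψ (monomialOn B g) = 0 := by
  have hnot : monomialOn B f ∉
      Submodule.span ℝ (monomialOn B '' {g | r g f ∧ g ≠ f}) := by
    intro hmem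
    obtain ⟨c, hc, hsum⟩ := (Finsupp.mem_span_image_iff_linearCombination ℝ).1 hmem
    rw [Finsupp.mem_supported] at hc
    refine hf ⟨monomial (Finsupp.equivFunOnFinite.symm f) 1 -
      ∑ g ∈ c.support, monomial (Finsupp.equivFunOnFinite.symm g) (c g), ?_, ?_, ?_⟩
    · intro a ha
      have := congrFun hsum ⟨a, ha⟩
      simp only [Finsupp.linearCombination_apply, Finsupp.sum, Finset.sum_apply, Pi.smul_apply,
        monomialOn, smul_eq_mul] at this
      simp [eval_monomial, Finsupp.prod_fintype, this]
    · refine ⟨Finsupp.equivFunOnFinite.symm f, ?_, rfl⟩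
      rw [mem_support_iff, coeff_sub, coeff_monomial, if_pos rfl, coeff_sum,
        Finset.sum_eq_zero]
      · simp
      · intro g hg
        rw [coeff_monomial, if_neg]
        exact fun h => (hc hg).2 (Finsupp.equivFunOnFinite.symm.injective h)
    · intro d hd
      by_contra hdf
      rw [mem_support_iff, coeff_sub, coeff_monomial, if_neg, coeff_sum,
        Finset.sum_eq_zero] at hd
      · simp at hd
      · intro g hg
        rw [coeff_monomial, if_neg]
        rintro rfl
        exact hdf (hc hg).1
      · rintro rfl
        exact hdf ((hr.1 f f).elim id id)
  obtain ⟨ψ, h1, h2⟩ := Submodule.exists_dual_map_eq_bot_of_notMem hnot inferInstance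
  refine ⟨ψ, h1, fun g hg hne => ?_⟩
  have : ψ (monomialOn B g) ∈ Submodule.map ψ
      (Submodule.span ℝ (monomialOn B '' {g | r g f ∧ g ≠ f})) :=
    Submodule.mem_map_of_mem (Submodule.subset_span ⟨g, ⟨hg, hne⟩, rfl⟩)
  rwa [h2, Submodule.mem_bot] at this

lemma prod_add_pow {ι R : Type*} [Fintype ι] [DecidableEq ι] [CommSemiring R]
    (a y : ι → R) (h : ι → ℕ) :
    ∏ k, (a k + y k) ^ h k = ∑ i ∈ Fintype.piFinset fun k => Finset.range (h k + 1),
      (∏ k, a k ^ i k) * (∏ k, y k ^ (h k - i k)) * ∏ k, ((h k).choose (i k) : R) := by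
  simp_rw [add_pow, Finset.prod_univ_sum, Finset.prod_mul_distrib]

lemma add_mem_ESet {n : ℕ} {r : (Fin n → ℕ) → (Fin n → ℕ) → Prop}
    (hr : IsMonomialOrder n r) {A B : Set (Fin n → ℝ)} {e f : Fin n → ℕ}
    (he : e ∈ ESet r A) (hf : f ∈ ESet r B) : e + f ∈ ESet r (A + B) := by
  rintro ⟨p, hp, ⟨d₀, hd₀, hd₀ef⟩, hle⟩
  obtain ⟨ψ, hψf, hψ⟩ := exists_dual_of_mem_ESet hr hf
  have hψ' : ∀ g, ψ (monomialOn B g) ≠ 0 → r f g := by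
    intro g hg
    rcases hr.1 f g with h | h
    · exact h
    · by_cases hgf : g = f
      · exact hgf ▸ h
      · exact absurd (hψ g h hgf) hg
  let t : (Fin n →₀ ℕ) → (Fin n → ℕ) → ℝ := fun h i =>
    p.coeff h * ((∏ k, ((h k).choose (i k) : ℝ)) * ψ (monomialOn B fun k => h k - i k))
  let q : MvPolynomial (Fin n) ℝ := ∑ h ∈ p.support,
    ∑ i ∈ Fintype.piFinset fun k => Finset.range (h k + 1),
      monomial (Finsupp.equivFunOnFinite.symm i) (t h i)
  have hcoeff : ∀ d : Fin n →₀ ℕ, q.coeff d = ∑ h ∈ p.support, t h d := by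
    intro d
    simp only [q, coeff_sum, coeff_monomial]
    refine Finset.sum_congr rfl fun h _ => ?_
    have hiff : ∀ i : Fin n → ℕ, Finsupp.equivFunOnFinite.symm i = d ↔ i = ⇑d := fun i =>
      Finsupp.equivFunOnFinite.symm_apply_eq
    simp only [hiff, Finset.sum_ite_eq']
    split_ifs with hmem
    · rfl
    · have : ∃ k, h k < d k := by
        simpa [Fintype.mem_piFinset, Nat.lt_succ_iff] using hmem
      obtain ⟨k, hk⟩ := this
      have : ∏ k, ((h k).choose (d k) : ℝ) = 0 :=
        Finset.prod_eq_zero (Finset.mem_univ k) (by simp [Nat.choose_eq_zero_of_lt hk])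
      simp [t, this]
  have hterm : ∀ h ∈ p.support, ∀ d : Fin n →₀ ℕ, t h d ≠ 0 →
      r (d + f) h ∧ r h (e + f) := by
    intro h hh d ht
    refine ⟨?_, hle h hh⟩
    have h1 := right_ne_zero_of_mul ht
    have h2 := left_ne_zero_of_mul h1
    have h3 := hψ' _ (right_ne_zero_of_mul h1)
    have hdh : ∀ k, d k ≤ h k := by
      intro k
      by_contra! hk
      exact h2 (Finset.prod_eq_zero (Finset.mem_univ k) (by simp [Nat.choose_eq_zero_of_lt hk]))
    have h4 := hr.2.2.2.2 _ _ (⇑d) h3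
    have h5 : (fun k => h k - d k) + ⇑d = ⇑h := by
      ext k
      simp [hdh k]
    rwa [h5, add_comm] at h4
  refine he ⟨q, ?_, ⟨Finsupp.equivFunOnFinite.symm e, ?_, rfl⟩, ?_⟩
  · intro a ha
    have hzero : (∑ h ∈ p.support, ∑ i ∈ Fintype.piFinset fun k => Finset.range (h k + 1),
        (p.coeff h * ((∏ k, a k ^ i k) * ∏ k, ((h k).choose (i k) : ℝ))) •
          monomialOn B fun k => h k - i k) = 0 := by
      ext ⟨y, hy⟩
      have := hp (a + y) (Set.add_mem_add ha hy)
      rw [eval_eq'] at this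
      simp only [Pi.add_apply, prod_add_pow, Finset.mul_sum] at this
      simp only [Finset.sum_apply, Pi.smul_apply, smul_eq_mul, monomialOn, Pi.zero_apply]
      rw [← this]
      refine Finset.sum_congr rfl fun h _ => Finset.sum_congr rfl fun i _ => ?_
      ring
    have := congrArg ψ hzero
    simp only [map_sum, map_smul, map_zero, smul_eq_mul] at this
    simp only [q, map_sum, eval_monomial, Finsupp.prod_fintype, pow_zero, implies_true,
      Finsupp.equivFunOnFinite_symm_apply_apply, t]
    rw [← this]
    refine Finset.sum_congr rfl fun h _ => Finset.sum_congr rfl fun i _ => ?_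
    ring
  · rw [mem_support_iff, hcoeff, Finset.sum_eq_single d₀]
    · have hsub : (fun k => d₀ k - e k) = f := by
        ext k
        simp [hd₀ef]
      refine mul_ne_zero (mem_support_iff.1 hd₀) (mul_ne_zero ?_ ?_)
      · refine Finset.prod_ne_zero_iff.2 fun k _ => ?_
        simp [hd₀ef, Nat.choose_eq_zero_iff]
      · simpa [hsub] using hψf
    · intro h hh hne
      by_contra ht
      obtain ⟨h1, h2⟩ := hterm h hh _ ht
      exact hne (DFunLike.coe_injective ((hr.2.1 _ _ h2 h1).trans hd₀ef.symm))
    · exact fun h => absurd hd₀ h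
  · intro d hd
    rw [mem_support_iff, hcoeff] at hd
    obtain ⟨h, hh, ht⟩ := Finset.exists_ne_zero_of_sum_ne_zero hd
    obtain ⟨h1, h2⟩ := hterm h hh d ht
    exact hr.le_of_add_le_add (hr.2.2.1 _ _ _ h1 h2)

lemma ESet_translate {n : ℕ} {r : (Fin n → ℕ) → (Fin n → ℕ) → Prop}
    (hr : IsMonomialOrder n r) (A : Set (Fin n → ℝ)) (v : Fin n → ℝ) :
    ESet r A ⊆ ESet r (A + {v}) := fun e he => by
  simpa using add_mem_ESet hr he (zero_mem_ESet_singleton hr v)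

lemma add_mem_latticePoints {n : ℕ} {x y : Fin n → ℝ} (hx : x ∈ latticePoints n)
    (hy : y ∈ latticePoints n) : x + y ∈ latticePoints n := fun i => by
  obtain ⟨a, ha⟩ := hx i
  obtain ⟨b, hb⟩ := hy i
  exact ⟨a + b, by simp [ha, hb]⟩

lemma neg_mem_latticePoints {n : ℕ} {x : Fin n → ℝ} (hx : x ∈ latticePoints n) :
    -x ∈ latticePoints n := fun i => by
  obtain ⟨a, ha⟩ := hx i
  exact ⟨-a, by simp [ha]⟩

lemma natCast_smul_mem_latticePoints {n : ℕ} {x : Fin n → ℝ} (m : ℕ)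
    (hx : x ∈ latticePoints n) : (m : ℝ) • x ∈ latticePoints n := fun i => by
  obtain ⟨a, ha⟩ := hx i
  exact ⟨m * a, by simp [ha]⟩

lemma add_mem_ESet_smul {n : ℕ} {r : (Fin n → ℕ) → (Fin n → ℕ) → Prop}
    (hr : IsMonomialOrder n r) {P : Set (Fin n → ℝ)} (hc : Convex ℝ P) {s t : ℝ}
    (hs : 0 ≤ s) (ht : 0 ≤ t) {e f : Fin n → ℕ}
    (he : e ∈ ESet r (s • P ∩ latticePoints n)) (hf : f ∈ ESet r (t • P ∩ latticePoints n)) :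
    e + f ∈ ESet r ((s + t) • P ∩ latticePoints n) := by
  refine ESet_mono r ?_ (add_mem_ESet hr he hf)
  rintro _ ⟨x, ⟨hxP, hxL⟩, y, ⟨hyP, hyL⟩, rfl⟩
  refine ⟨?_, add_mem_latticePoints hxL hyL⟩
  rw [hc.add_smul hs ht]
  exact Set.add_mem_add hxP hyP

lemma nsmul_mem_ESet_smul {n : ℕ} {r : (Fin n → ℕ) → (Fin n → ℕ) → Prop}
    (hr : IsMonomialOrder n r) {P : Set (Fin n → ℝ)} (hc : Convex ℝ P) {s : ℝ}
    (hs : 0 ≤ s) {e : Fin n → ℕ} (he : e ∈ ESet r (s • P ∩ latticePoints n)) {m : ℕ}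
    (hm : 1 ≤ m) : m • e ∈ ESet r ((m * s) • P ∩ latticePoints n) := by
  induction m, hm using Nat.le_induction with
  | base => simpa using he
  | succ m hm ih =>
    have := add_mem_ESet_smul hr hc (by positivity) hs ih he
    rwa [← succ_nsmul, show (m : ℝ) * s + s = ((m + 1 : ℕ) : ℝ) * s by push_cast; ring] at this

lemma div_two_pow_mem_SP {n : ℕ} {r : (Fin n → ℕ) → (Fin n → ℕ) → Prop}
    {P : Set (Fin n → ℝ)} {k : ℕ} {e : Fin n → ℕ}
    (he : e ∈ ESet r ((2 ^ k : ℝ) • P ∩ latticePoints n)) :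
    (fun i => (e i : ℝ) / 2 ^ k) ∈ SP r P :=
  subset_closure (Set.mem_iUnion.2 ⟨k, e, he, rfl⟩)

lemma SP_subset_of_isClosed {n : ℕ} {r : (Fin n → ℕ) → (Fin n → ℕ) → Prop}
    {P T : Set (Fin n → ℝ)} (hT : IsClosed T)
    (h : ∀ (k : ℕ) (e : Fin n → ℕ), e ∈ ESet r ((2 ^ k : ℝ) • P ∩ latticePoints n) →
      (fun i => (e i : ℝ) / 2 ^ k) ∈ T) : SP r P ⊆ T := by
  refine closure_minimal (Set.iUnion_subset fun k => ?_) hT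
  rintro _ ⟨e, he, rfl⟩
  exact h k e he

lemma SP_mono {n : ℕ} (r : (Fin n → ℕ) → (Fin n → ℕ) → Prop) {P Q : Set (Fin n → ℝ)}
    (h : P ⊆ Q) : SP r P ⊆ SP r Q :=
  SP_subset_of_isClosed isClosed_closure fun _ _ he => div_two_pow_mem_SP
    (ESet_mono r (Set.inter_subset_inter_left _ (Set.smul_set_mono h)) he)

lemma Convex.smul_subset_smul_of_zero_mem {E : Type*} [AddCommGroup E] [Module ℝ E]
    {P : Set E} (hc : Convex ℝ P) (h0 : 0 ∈ P) {a b : ℝ} (ha : 0 ≤ a) (hb : 0 < b)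
    (hab : a ≤ b) : a • P ⊆ b • P := by
  rintro _ ⟨x, hx, rfl⟩
  refine ⟨(a / b) • x, hc.smul_mem_of_zero_mem h0 hx
    ⟨by positivity, (div_le_one hb).2 hab⟩, ?_⟩
  simp [smul_smul, mul_div_cancel₀ _ hb.ne']

lemma smul_mem_SP_smul_of_zero_mem {n : ℕ} {r : (Fin n → ℕ) → (Fin n → ℕ) → Prop}
    (hr : IsMonomialOrder n r) {P : Set (Fin n → ℝ)} (hc : Convex ℝ P) (h0 : 0 ∈ P)
    {c : ℝ} (hc0 : 0 < c) {x : Fin n → ℝ} (hx : x ∈ SP r P) : c • x ∈ SP r (c • P) := by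
  refine SP_subset_of_isClosed (T := (fun x => c • x) ⁻¹' SP r (c • P))
    (isClosed_closure.preimage (continuous_const_smul c)) (fun k e he => ?_) hx
  have hpow : Filter.Tendsto (fun j : ℕ => (2 : ℝ) ^ j) Filter.atTop Filter.atTop :=
    tendsto_pow_atTop_atTop_of_one_lt one_lt_two
  have hlim : Filter.Tendsto (fun j : ℕ => ((⌊c * 2 ^ j⌋₊ : ℝ) / 2 ^ j)) Filter.atTop
      (nhds c) := (tendsto_nat_floor_mul_div_atTop hc0.le).comp hpow
  refine isClosed_closure.mem_of_tendsto
    (hlim.smul_const (fun i => (e i : ℝ) / 2 ^ k)) ?_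
  filter_upwards [hpow.eventually_ge_atTop c⁻¹] with j hj
  have h1 : 1 ≤ c * 2 ^ j := by
    calc 1 = c * c⁻¹ := (mul_inv_cancel₀ hc0.ne').symm
      _ ≤ c * 2 ^ j := by gcongr
  have hm : 1 ≤ ⌊c * 2 ^ j⌋₊ := Nat.le_floor (by simpa using h1)
  have hfl : (⌊c * 2 ^ j⌋₊ : ℝ) ≤ c * 2 ^ j := Nat.floor_le (by positivity)
  set m := ⌊c * 2 ^ j⌋₊
  have hme := nsmul_mem_ESet_smul hr hc (by positivity) he hm
  have hsub : ((m : ℝ) * 2 ^ k) • P ⊆ (2 ^ (k + j) : ℝ) • c • P := by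
    rw [smul_smul]
    refine hc.smul_subset_smul_of_zero_mem h0 (by positivity) (by positivity) ?_
    calc (m : ℝ) * 2 ^ k ≤ c * 2 ^ j * 2 ^ k := by gcongr
      _ = 2 ^ (k + j) * c := by ring
  have heq : ((m : ℝ) / 2 ^ j) • (fun i => (e i : ℝ) / 2 ^ k) =
      fun i => ((m • e) i : ℝ) / 2 ^ (k + j) := by
    ext i
    simp only [Pi.smul_apply, smul_eq_mul, Nat.cast_mul]
    rw [pow_add]
    field_simp
  rw [heq]
  exact div_two_pow_mem_SP (ESet_mono r (Set.inter_subset_inter_left _ hsub) hme)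

lemma SP_add_singleton_subset_of_dyadic {n : ℕ} {r : (Fin n → ℕ) → (Fin n → ℕ) → Prop}
    (hr : IsMonomialOrder n r) {P : Set (Fin n → ℝ)} (hc : Convex ℝ P) {m : ℕ}
    {w : Fin n → ℝ} (hw : (2 ^ m : ℝ) • w ∈ latticePoints n) :
    SP r (P + {w}) ⊆ SP r P := by
  refine SP_subset_of_isClosed isClosed_closure fun k e he => ?_
  have h1 := nsmul_mem_ESet_smul hr (hc.add (convex_singleton w)) (by positivity) he
    (Nat.one_le_two_pow (n := m))
  have hL : (2 ^ (k + m) : ℝ) • w ∈ latticePoints n := by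
    have := natCast_smul_mem_latticePoints (2 ^ k) hw
    rwa [smul_smul, Nat.cast_pow, Nat.cast_ofNat, ← pow_add] at this
  have h2 : 2 ^ m • e ∈ ESet r ((2 ^ (k + m) : ℝ) • P ∩ latticePoints n) := by
    refine ESet_mono r ?_ (ESet_translate hr _ (-((2 ^ (k + m) : ℝ) • w)) h1)
    rintro _ ⟨_, ⟨⟨_, ⟨x, hx, _, rfl, rfl⟩, rfl⟩, hyL⟩, _, rfl, rfl⟩
    refine ⟨⟨x, hx, ?_⟩, add_mem_latticePoints hyL (neg_mem_latticePoints hL)⟩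
    ext i
    simp
    ring
  convert div_two_pow_mem_SP h2 using 1
  ext i
  simp only [Pi.smul_apply, smul_eq_mul, Nat.cast_mul, Nat.cast_pow, Nat.cast_ofNat]
  rw [pow_add]
  field_simp

lemma exists_dyadic_norm_sub_lt {n : ℕ} (v : Fin n → ℝ) {δ : ℝ} (hδ : 0 < δ) :
    ∃ (m : ℕ) (w : Fin n → ℝ), (2 ^ m : ℝ) • w ∈ latticePoints n ∧ ‖v - w‖ < δ := by
  obtain ⟨m, hm⟩ := exists_pow_lt_of_lt_one hδ (by norm_num : (1 / 2 : ℝ) < 1)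
  refine ⟨m, fun i => ⌊2 ^ m * v i⌋ / 2 ^ m, fun i => ⟨⌊2 ^ m * v i⌋, ?_⟩, ?_⟩
  · simp [mul_div_cancel₀]
  · refine (pi_norm_lt_iff hδ).2 fun i => lt_of_le_of_lt ?_ hm
    have h1 := Int.floor_le (2 ^ m * v i)
    have h2 := (Int.lt_floor_add_one (2 ^ m * v i)).le
    have hp : (0 : ℝ) < 2 ^ m := by positivity
    have h3 : v i - (⌊2 ^ m * v i⌋ : ℝ) / 2 ^ m = (2 ^ m * v i - ⌊2 ^ m * v i⌋) / 2 ^ m := by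
      field_simp
    rw [Pi.sub_apply, h3, Real.norm_eq_abs, abs_of_nonneg (div_nonneg (by linarith) hp.le),
      one_div, inv_pow, ← one_div]
    gcongr
    linarith

lemma SP_add_singleton_subset_of_zero_mem_interior {n : ℕ}
    {r : (Fin n → ℕ) → (Fin n → ℕ) → Prop} (hr : IsMonomialOrder n r)
    {P : Set (Fin n → ℝ)} (hc : Convex ℝ P) (h0 : 0 ∈ interior P) (v : Fin n → ℝ) :
    SP r (P + {v}) ⊆ SP r P := by
  obtain ⟨ε, hε, hball⟩ := Metric.mem_nhds_iff.1 (mem_interior_iff_mem_nhds.1 h0)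
  have hscale : ∀ t : ℝ, 0 < t → SP r (P + {v}) ⊆ SP r ((1 + t) • P) := by
    intro t ht
    obtain ⟨m, w, hw, hvw⟩ := exists_dyadic_norm_sub_lt v (mul_pos ht hε)
    have h1 : P + {v} = (P + {v - w}) + {w} := by
      rw [add_assoc, Set.singleton_add_singleton, sub_add_cancel]
    rw [h1]
    refine (SP_add_singleton_subset_of_dyadic hr (hc.add (convex_singleton _)) hw).trans
      (SP_mono r ?_)
    rw [hc.add_smul zero_le_one ht.le, one_smul]
    refine Set.add_subset_add_left (Set.singleton_subset_iff.2 ?_)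
    refine (Set.mem_smul_set_iff_inv_smul_mem₀ ht.ne' _ _).2 (hball ?_)
    rw [mem_ball_zero_iff, norm_smul, norm_inv, Real.norm_of_nonneg ht.le,
      inv_mul_lt_iff₀ ht]
    exact hvw
  intro x hx
  have hmem : ∀ t : ℝ, 0 < t → (1 + t)⁻¹ • x ∈ SP r P := by
    intro t ht
    have ht1 : 0 < 1 + t := by positivity
    have := smul_mem_SP_smul_of_zero_mem hr (hc.smul (1 + t))
      (Set.zero_mem_smul_set (interior_subset h0)) (inv_pos.2 ht1) (hscale t ht hx)
    rwa [smul_smul, inv_mul_cancel₀ ht1.ne', one_smul] at this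
  have hlim : Filter.Tendsto (fun t : ℝ => (1 + t)⁻¹ • x) (nhdsWithin 0 (Set.Ioi 0))
      (nhds ((1 + 0 : ℝ)⁻¹ • x)) := by
    refine Filter.Tendsto.mono_left ?_ nhdsWithin_le_nhds
    have : ContinuousAt (fun t : ℝ => (1 + t)⁻¹) 0 :=
      (continuousAt_const.add continuousAt_id).inv₀ (by simp)
    exact this.tendsto.smul_const x
  have : (1 + 0 : ℝ)⁻¹ • x ∈ SP r P := isClosed_closure.mem_of_tendsto hlim
    (Filter.eventually_of_mem self_mem_nhdsWithin hmem)
  simpa using this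

lemma SP_add_singleton_subset {n : ℕ} {r : (Fin n → ℕ) → (Fin n → ℕ) → Prop}
    (hr : IsMonomialOrder n r) {P : Set (Fin n → ℝ)} (hc : Convex ℝ P)
    (hP : (interior P).Nonempty) (v : Fin n → ℝ) : SP r (P + {v}) ⊆ SP r P := by
  obtain ⟨x, hx⟩ := hP
  obtain ⟨ε, hε, hball⟩ := Metric.isOpen_iff.1 isOpen_interior x hx
  obtain ⟨m, w, hw, hxw⟩ := exists_dyadic_norm_sub_lt x hε
  have hwP : w ∈ interior P := hball (by rwa [mem_ball_iff_norm'])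
  have h0 : 0 ∈ interior (P + {-w}) := by
    refine interior_maximal (Set.add_subset_add_right interior_subset)
      (isOpen_interior.add_right) ?_
    exact ⟨w, hwP, -w, rfl, add_neg_cancel w⟩
  have hcw : Convex ℝ (P + {-w}) := hc.add (convex_singleton _)
  have hnw : (2 ^ m : ℝ) • -w ∈ latticePoints n := by
    rw [smul_neg]
    exact neg_mem_latticePoints hw
  have hw_eq : SP r (P + {-w}) ⊆ SP r P := SP_add_singleton_subset_of_dyadic hr hc hnw
  have hle := SP_add_singleton_subset_of_zero_mem_interior hr hcw h0 (w + v)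
  rw [add_assoc, Set.singleton_add_singleton, neg_add_cancel_left] at hle
  exact hle.trans hw_eq

lemma SP_add_singleton {n : ℕ} {r : (Fin n → ℕ) → (Fin n → ℕ) → Prop}
    (hr : IsMonomialOrder n r) {P : Set (Fin n → ℝ)} (hc : Convex ℝ P)
    (hP : (interior P).Nonempty) (v : Fin n → ℝ) : SP r (P + {v}) = SP r P := by
  refine (SP_add_singleton_subset hr hc hP v).antisymm ?_
  have hPv : (interior (P + {v})).Nonempty :=
    (hP.add (Set.singleton_nonempty v)).mono
      (interior_maximal (Set.add_subset_add_right interior_subset) isOpen_interior.add_right)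
  have := SP_add_singleton_subset hr (hc.add (convex_singleton v)) hPv (-v)
  rwa [add_assoc, Set.singleton_add_singleton, add_neg_cancel, Set.singleton_zero,
    add_zero] at this

lemma SP_smul_of_zero_mem {n : ℕ} {r : (Fin n → ℕ) → (Fin n → ℕ) → Prop}
    (hr : IsMonomialOrder n r) {P : Set (Fin n → ℝ)} (hc : Convex ℝ P) (h0 : 0 ∈ P)
    {d : ℝ} (hd : 0 < d) : SP r (d • P) = d • SP r P := by
  refine Set.Subset.antisymm (fun x hx => ?_) ?_
  · rw [Set.mem_smul_set_iff_inv_smul_mem₀ hd.ne']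
    have := smul_mem_SP_smul_of_zero_mem hr (hc.smul d) (Set.zero_mem_smul_set h0)
      (inv_pos.2 hd) hx
    rwa [smul_smul, inv_mul_cancel₀ hd.ne', one_smul] at this
  · rintro _ ⟨x, hx, rfl⟩
    exact smul_mem_SP_smul_of_zero_mem hr hc h0 hd hx

lemma Convex.interior_nonempty_of_volume_pos {n : ℕ} {P : Set (Fin n → ℝ)} (hc : Convex ℝ P)
    (hv : 0 < volume P) : (interior P).Nonempty := by
  by_contra! h
  have hsub : P ⊆ frontier P := by
    rw [frontier, h, Set.sdiff_empty]
    exact subset_closure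
  exact hv.ne' (measure_mono_null hsub (hc.addHaar_frontier volume))

/-- For a bounded convex set `P ⊆ ℝⁿ` of positive Lebesgue measure,
`S_{d·P} = d·S_P` for every real `d > 0`, and `S_{P+v} = S_P` for every `v ∈ ℝⁿ`. -/
theorem SP_smul_and_translate {n : ℕ}
    (r : (Fin n → ℕ) → (Fin n → ℕ) → Prop) (hr : IsMonomialOrder n r)
    (P : Set (Fin n → ℝ)) (hb : Bornology.IsBounded P) (hc : Convex ℝ P)
    (hv : 0 < volume P) :
    (∀ d : ℝ, 0 < d → SP r (d • P) = d • SP r P) ∧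
    (∀ v : Fin n → ℝ, SP r ((fun x => x + v) '' P) = SP r P) := by
  have hP := hc.interior_nonempty_of_volume_pos hv
  refine ⟨fun d hd => ?_, fun v => ?_⟩
  · obtain ⟨w, hw⟩ := hP
    have hPd : (interior (d • P)).Nonempty :=
      hc.smul d |>.interior_nonempty_of_volume_pos (by
        rw [Measure.addHaar_smul]
        exact ENNReal.mul_pos (by simp [hd.ne']) hv.ne')
    have h0 : (0 : Fin n → ℝ) ∈ P + {-w} :=
      ⟨w, interior_subset hw, -w, rfl, add_neg_cancel w⟩
    calc SP r (d • P) = SP r (d • P + {d • -w}) :=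
          (SP_add_singleton hr (hc.smul d) hPd _).symm
      _ = SP r (d • (P + {-w})) := by rw [smul_add, Set.smul_set_singleton]
      _ = d • SP r (P + {-w}) :=
          SP_smul_of_zero_mem hr (hc.add (convex_singleton _)) h0 hd
      _ = d • SP r P := by rw [SP_add_singleton hr hc ⟨w, hw⟩]
  · rw [← Set.add_singleton]
    exact SP_add_singleton hr hc hP v
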